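/- Let 2 < q < p ≤ 6 and α < 0. (i) If p < 6 and μ > 0, then −∞ < 𝓔_{p,q,α}(μ) ≤ 0 and E_{p,q,α} is coercive on H¹_μ(ℝ): every sequence (u_n) ⊂ H¹_μ(ℝ) with sup_n E_{p,q,α}(u_n) < ∞ satisfies sup_n ∫_ℝ |u_n′|² dx < ∞. (ii) If p = 6 and μ > μ_ℝ, then 𝓔_{6,q,α}(μ) = −∞. (iii) If p = 6 and 0 < μ ≤ μ_ℝ, then 𝓔_{6,q,α}(μ) = 0 and no u ∈ H¹_μ(ℝ) attains this infimum. -/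

import Mathlib

open MeasureTheory

/-- The NLS energy with combined nonlinearities on the real line. -/
noncomputable def NLSenergy (p q α : ℝ) (u : ℝ → ℝ) : ℝ :=
  ∫ x : ℝ, ((1 / 2) * (deriv u x) ^ 2 - (1 / p) * |u x| ^ p - (α / q) * |u x| ^ q)

/-- Membership in H¹_μ(ℝ): differentiable, u and u′ square-integrable, mass μ. -/
def InH1mass (μ : ℝ) (u : ℝ → ℝ) : Prop :=
  Differentiable ℝ u ∧ (Integrable fun x => (u x) ^ 2) ∧
    (Integrable fun x => (deriv u x) ^ 2) ∧ (∫ x : ℝ, (u x) ^ 2) = μ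

/-- The ground-state energy level 𝓔_{p,q,α}(μ), as an extended real number. -/
noncomputable def groundLevel (p q α μ : ℝ) : EReal :=
  sInf ((fun u : ℝ → ℝ => ((NLSenergy p q α u : ℝ) :  EReal)) '' {u | InH1mass μ u})

/-- The critical mass of the real line: μ_ℝ = (√3/2)π. -/
noncomputable def muR : ℝ := Real.sqrt 3 / 2 * Real.pi

open Set Filter Topology

lemma two_mul_le_integral_abs_deriv {w w' : ℝ → ℝ} (hw : ∀ x, HasDerivAt w (w' x) x)
    (hint : Integrable w') (hbot : Tendsto w atBot (𝓝 0)) (htop : Tendsto w atTop (𝓝 0)) (a : ℝ) :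
    2 * w a ≤ ∫ x, |w' x| := by
  have h1 := integral_Iic_of_hasDerivAt_of_tendsto' (fun x _ => hw x)
    (hint.integrableOn (s := Iic a)) hbot
  have h2 := integral_Ioi_of_hasDerivAt_of_tendsto' (fun x _ => hw x)
    (hint.integrableOn (s := Ioi a)) htop
  have h3 : ∫ x, |w' x| = (∫ x in Iic a, |w' x|) + ∫ x in Ioi a, |w' x| := by
    rw [← setIntegral_univ, ← Iic_union_Ioi (a := a), setIntegral_union (Iic_disjoint_Ioi le_rfl)
      measurableSet_Ioi hint.abs.integrableOn hint.abs.integrableOn]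
  have h4 := (le_abs_self _).trans (abs_integral_le_integral_abs (f := w') (μ := volume.restrict (Iic a)))
  have h5 := (neg_abs_le _).trans' (neg_le_neg
    (abs_integral_le_integral_abs (f := w') (μ := volume.restrict (Ioi a))))
  linarith

namespace InH1mass

variable {μ : ℝ} {u : ℝ → ℝ}

lemma hasDerivAt_sq (hu : InH1mass μ u) (x : ℝ) :
    HasDerivAt (fun x => u x ^ 2) (2 * (u x * deriv u x)) x := by
  simpa [mul_assoc] using (hu.1 x).hasDerivAt.fun_pow 2

lemma integrable_mul_deriv (hu : InH1mass μ u) : Integrable fun x => u x * deriv u x := by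
  refine (hu.2.1.add hu.2.2.1).mono'
    (hu.1.continuous.measurable.mul (measurable_deriv u)).aestronglyMeasurable (.of_forall fun x => ?_)
  simp only [Real.norm_eq_abs, Pi.add_apply]
  rw [abs_le]
  constructor <;> nlinarith [sq_nonneg (u x + deriv u x), sq_nonneg (u x - deriv u x)]

lemma tendsto_sq_atTop (hu : InH1mass μ u) : Tendsto (fun x => u x ^ 2) atTop (𝓝 0) :=
  tendsto_zero_of_hasDerivAt_of_integrableOn_Ioi (a := 0) (fun x _ => hu.hasDerivAt_sq x)
    (hu.integrable_mul_deriv.const_mul 2).integrableOn hu.2.1.integrableOn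

lemma tendsto_sq_atBot (hu : InH1mass μ u) : Tendsto (fun x => u x ^ 2) atBot (𝓝 0) :=
  tendsto_zero_of_hasDerivAt_of_integrableOn_Iic (a := 0) (fun x _ => hu.hasDerivAt_sq x)
    (hu.integrable_mul_deriv.const_mul 2).integrableOn hu.2.1.integrableOn

lemma exists_isMaxOn_sq (hu : InH1mass μ u) (hμ : 0 < μ) :
    ∃ a, 0 < u a ^ 2 ∧ ∀ x, u x ^ 2 ≤ u a ^ 2 := by
  obtain ⟨b, hb⟩ : ∃ b, u b ≠ 0 := by
    by_contra! h
    have := hu.2.2.2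
    simp [h] at this
    exact hμ.ne this
  have hb' : 0 < u b ^ 2 := by positivity
  obtain ⟨a, ha⟩ := (hu.1.continuous.pow 2).exists_forall_ge' b (by
    rw [cocompact_eq_atBot_atTop, eventually_sup]
    exact ⟨(hu.tendsto_sq_atBot.eventually (gt_mem_nhds hb')).mono fun x hx => hx.le,
      (hu.tendsto_sq_atTop.eventually (gt_mem_nhds hb')).mono fun x hx => hx.le⟩)
  exact ⟨a, hb'.trans_le (ha b), ha⟩

lemma sq_sq_le (hu : InH1mass μ u) (hμ : 0 < μ) (a : ℝ) :
    (u a ^ 2) ^ 2 ≤ μ * ∫ x, deriv u x ^ 2 := by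
  have h1 := two_mul_le_integral_abs_deriv hu.hasDerivAt_sq
    (hu.integrable_mul_deriv.const_mul 2) hu.tendsto_sq_atBot hu.tendsto_sq_atTop a
  set m := u a ^ 2
  have h2 : (∫ x, m * μ * |2 * (u x * deriv u x)|) ≤ ∫ x, (m ^ 2 * u x ^ 2 + μ ^ 2 * deriv u x ^ 2) := by
    refine integral_mono ((hu.integrable_mul_deriv.const_mul 2).abs.const_mul _)
      ((hu.2.1.const_mul _).add (hu.2.2.1.const_mul _)) fun x => ?_
    simp only [abs_mul, abs_two]
    have := sq_nonneg (m * |u x| - μ * |deriv u x|)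
    rw [← sq_abs (u x), ← sq_abs (deriv u x)]
    linarith
  rw [integral_const_mul, integral_add (hu.2.1.const_mul _) (hu.2.2.1.const_mul _),
    integral_const_mul, integral_const_mul, hu.2.2.2] at h2
  have hm : 0 ≤ m := sq_nonneg _
  have h3 := mul_le_mul_of_nonneg_left h1 (mul_nonneg hm hμ.le)
  nlinarith

lemma integrable_abs_rpow (hu : InH1mass μ u) (hμ : 0 < μ) {r : ℝ} (hr : 2 ≤ r) :
    Integrable fun x => |u x| ^ r := by
  obtain ⟨a, ha, hmax⟩ := hu.exists_isMaxOn_sq hμ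
  refine (hu.2.1.const_mul (|u a| ^ (r - 2))).mono'
    (hu.1.continuous.abs.rpow_const fun x => .inr (by linarith)).aestronglyMeasurable
    (.of_forall fun x => ?_)
  rw [Real.norm_of_nonneg (by positivity)]
  rcases eq_or_ne (u x) 0 with h | h
  · rw [h, abs_zero, Real.zero_rpow (by linarith)]
    simp
  have h0 : 0 < |u x| := abs_pos.2 h
  calc |u x| ^ r = |u x| ^ (r - 2) * |u x| ^ (2 : ℝ) := by rw [← Real.rpow_add h0]; ring_nf
    _ = |u x| ^ (r - 2) * u x ^ 2 := by rw [Real.rpow_two, sq_abs]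
    _ ≤ _ := by
      exact mul_le_mul_of_nonneg_right (Real.rpow_le_rpow h0.le (sq_le_sq.1 (hmax x))
        (by linarith)) (sq_nonneg _)

lemma NLSenergy_eq (hu : InH1mass μ u) (hμ : 0 < μ) {p q : ℝ} (α : ℝ) (hp : 2 ≤ p) (hq : 2 ≤ q) :
    NLSenergy p q α u = (1 / 2) * (∫ x, deriv u x ^ 2) - (1 / p) * (∫ x, |u x| ^ p)
      - (α / q) * ∫ x, |u x| ^ q := by
  have h1 := hu.2.2.1.const_mul (1 / 2)
  have h2 := (hu.integrable_abs_rpow hμ hp).const_mul (1 / p)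
  have h3 := (hu.integrable_abs_rpow hμ hq).const_mul (α / q)
  have h12 : Integrable fun x => 1 / 2 * deriv u x ^ 2 - 1 / p * |u x| ^ p := h1.sub h2
  unfold NLSenergy
  rw [integral_sub h12 h3, integral_sub h1 h2, integral_const_mul, integral_const_mul,
    integral_const_mul]

lemma integral_abs_rpow_pos (hu : InH1mass μ u) (hμ : 0 < μ) {r : ℝ} (hr : 2 ≤ r) :
    0 < ∫ x, |u x| ^ r := by
  obtain ⟨a, ha, -⟩ := hu.exists_isMaxOn_sq hμ
  refine integral_pos_of_integrable_nonneg_nonzero (x := a)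
    (hu.1.continuous.abs.rpow_const fun x => .inr (by linarith)) (hu.integrable_abs_rpow hμ hr)
    (fun x => by positivity) (Real.rpow_pos_of_pos (abs_pos.2 fun h => ?_) r).ne'
  simp [h] at ha

end InH1mass

/-- The integral of `√(1 - s²)` over `[0, t]`. -/
noncomputable def circleArea (t : ℝ) : ℝ := ∫ s in (0 : ℝ)..t, √(1 - s ^ 2)

lemma hasDerivAt_circleArea (t : ℝ) : HasDerivAt circleArea √(1 - t ^ 2) t :=
  (show Continuous fun s : ℝ => √(1 - s ^ 2) by fun_prop).integral_hasStrictDerivAt 0 t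
    |>.hasDerivAt

lemma circleArea_zero : circleArea 0 = 0 := by simp [circleArea]

lemma circleArea_one : circleArea 1 = Real.pi / 4 := by
  have hc : Continuous fun s : ℝ => √(1 - s ^ 2) := by fun_prop
  have h1 := integral_sqrt_one_sub_sq
  rw [← intervalIntegral.integral_add_adjacent_intervals (b := 0) (hc.intervalIntegrable _ _)
    (hc.intervalIntegrable _ _)] at h1
  have h2 := intervalIntegral.integral_comp_neg (a := 0) (b := 1) fun s : ℝ => √(1 - s ^ 2)
  simp only [even_two.neg_pow, neg_zero] at h2
  rw [← h2] at h1
  unfold circleArea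
  linarith

/-- The sharp critical Gagliardo–Nirenberg inequality with remainder. -/
lemma InH1mass.sharp_critical_bound {μ : ℝ} {u : ℝ → ℝ} (hu : InH1mass μ u) (hμ : 0 < μ) :
    ∃ m > 0, m ^ 2 * (muR - μ) ≤ 3 * (∫ x, deriv u x ^ 2) - ∫ x, |u x| ^ (6 : ℝ) := by
  obtain ⟨a, ha, hmax⟩ := hu.exists_isMaxOn_sq hμ
  refine ⟨u a ^ 2, ha, ?_⟩
  set m := u a ^ 2 with hm
  set w' : ℝ → ℝ := fun x => √(1 - (u x ^ 2 / m) ^ 2) * (2 * (u x * deriv u x) / m) with hw'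
  have hderiv (x : ℝ) : HasDerivAt (fun x => circleArea (u x ^ 2 / m)) (w' x) x :=
    (hasDerivAt_circleArea _).comp x ((hu.hasDerivAt_sq x).div_const m)
  have hlim {l : Filter ℝ} (hl : Tendsto (fun x => u x ^ 2) l (𝓝 0)) :
      Tendsto (fun x => circleArea (u x ^ 2 / m)) l (𝓝 0) := by
    have h := (hasDerivAt_circleArea 0).continuousAt.tendsto.comp
      (by simpa using hl.div_const m : Tendsto (fun x => u x ^ 2 / m) l (𝓝 0))
    rwa [circleArea_zero] at h
  have hint : Integrable w' := by
    refine ((hu.integrable_mul_deriv.const_mul 2).div_const m).abs.mono'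
      ((Continuous.measurable (by have := hu.1.continuous; fun_prop)).mul
        (((hu.1.continuous.measurable.mul (measurable_deriv u)).const_mul 2).div_const
          m)).aestronglyMeasurable (.of_forall fun x => ?_)
    rw [Real.norm_eq_abs, hw', abs_mul]
    refine mul_le_of_le_one_left (abs_nonneg _) ?_
    rw [abs_of_nonneg (Real.sqrt_nonneg _), Real.sqrt_le_one]
    nlinarith [sq_nonneg (u x ^ 2 / m)]
  have h1 := two_mul_le_integral_abs_deriv hderiv hint (hlim hu.tendsto_sq_atBot)
    (hlim hu.tendsto_sq_atTop) a
  rw [← hm, div_self ha.ne', circleArea_one] at h1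
  have h6 := hu.integrable_abs_rpow hμ (r := 6) (by norm_num)
  have h36 : Integrable fun x => 3 * deriv u x ^ 2 - |u x| ^ (6 : ℝ) :=
    (hu.2.2.1.const_mul 3).sub h6
  have h2 : (∫ x, √3 * m ^ 2 * |w' x|) ≤
      ∫ x, (3 * deriv u x ^ 2 - |u x| ^ (6 : ℝ) + m ^ 2 * u x ^ 2) := by
    refine integral_mono (hint.abs.const_mul _)
      (h36.add (hu.2.1.const_mul _)) fun x => ?_
    have hr : (u x ^ 2 / m) ^ 2 ≤ 1 := by
      rw [sq_le_one_iff₀ (by positivity), div_le_one ha]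
      exact hmax x
    have hs := Real.sq_sqrt (sub_nonneg.2 hr)
    set s := √(1 - (u x ^ 2 / m) ^ 2) with hs'
    have hs0 : 0 ≤ s := Real.sqrt_nonneg _
    have h3 : √3 ^ 2 = 3 := Real.sq_sqrt (by norm_num)
    have h6' : |u x| ^ (6 : ℝ) = u x ^ 2 * m ^ 2 * (1 - s ^ 2) := by
      rw [hs]
      have : |u x| ^ (6 : ℝ) = (|u x| ^ 2) ^ 3 := by
        rw [← pow_mul]
        exact_mod_cast Real.rpow_natCast |u x| 6
      rw [this, sq_abs]
      field_simp
      ring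
    have hw : √3 * m ^ 2 * |w' x| = 2 * (√3 * |deriv u x|) * (m * (|u x| * s)) := by
      simp only [hw', ← hs', abs_mul, abs_div, abs_two, abs_of_pos ha, abs_of_nonneg hs0]
      field_simp
    simp only [hw, h6']
    have := sq_nonneg (√3 * |deriv u x| - m * (|u x| * s))
    rw [sub_sq, mul_pow, mul_pow, mul_pow, h3, sq_abs, sq_abs] at this
    linarith
  rw [integral_const_mul, integral_add h36 (hu.2.1.const_mul _),
    integral_sub (hu.2.2.1.const_mul 3) h6, integral_const_mul, integral_const_mul,
    hu.2.2.2] at h2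
  have h3 := mul_le_mul_of_nonneg_left h1 (by positivity : 0 ≤ √3 * m ^ 2)
  unfold muR
  linarith

section Scaling

variable {μ : ℝ} {u : ℝ → ℝ} {κ : ℝ}

/-- The mass-preserving dilation `√κ u(κ x)`. -/
noncomputable def massDilation (κ : ℝ) (u : ℝ → ℝ) (x : ℝ) : ℝ := √κ * u (κ * x)

lemma deriv_massDilation (hu : Differentiable ℝ u) (x : ℝ) :
    deriv (massDilation κ u) x = √κ * (κ * deriv u (κ * x)) := by
  have h := (((hu (κ * x)).hasDerivAt.comp x ((hasDerivAt_id x).const_mul κ)).const_mul √κ).deriv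
  rw [mul_one, mul_comm (deriv u _)] at h
  exact h

lemma deriv_massDilation_sq (hu : Differentiable ℝ u) (hκ : 0 < κ) (x : ℝ) :
    deriv (massDilation κ u) x ^ 2 = κ ^ 3 * deriv u (κ * x) ^ 2 := by
  rw [deriv_massDilation hu, mul_pow, Real.sq_sqrt hκ.le]
  ring

lemma massDilation_sq (hκ : 0 < κ) (x : ℝ) :
    massDilation κ u x ^ 2 = κ * u (κ * x) ^ 2 := by
  rw [massDilation, mul_pow, Real.sq_sqrt hκ.le]

lemma integral_deriv_massDilation_sq (hu : Differentiable ℝ u) (hκ : 0 < κ) :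
    ∫ x, deriv (massDilation κ u) x ^ 2 = κ ^ 2 * ∫ x, deriv u x ^ 2 := by
  simp_rw [deriv_massDilation_sq hu hκ]
  rw [integral_const_mul, Measure.integral_comp_mul_left (fun x => deriv u x ^ 2), smul_eq_mul,
    abs_of_pos (inv_pos.2 hκ)]
  field_simp

lemma integral_abs_massDilation_rpow (hκ : 0 < κ) (r : ℝ) :
    ∫ x, |massDilation κ u x| ^ r = κ ^ (r / 2 - 1) * ∫ x, |u x| ^ r := by
  have h (x : ℝ) : |massDilation κ u x| ^ r = κ ^ (r / 2) * |u (κ * x)| ^ r := by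
    rw [massDilation, abs_mul, Real.mul_rpow (abs_nonneg _) (abs_nonneg _),
      abs_of_nonneg (Real.sqrt_nonneg _), Real.sqrt_eq_rpow, ← Real.rpow_mul hκ.le]
    ring_nf
  simp_rw [h]
  rw [integral_const_mul, Measure.integral_comp_mul_left (fun x => |u x| ^ r), smul_eq_mul,
    abs_of_pos (inv_pos.2 hκ), Real.rpow_sub hκ, Real.rpow_one]
  field_simp

lemma InH1mass.massDilation (hu : InH1mass μ u) (hκ : 0 < κ) :
    InH1mass μ (massDilation κ u) := by
  refine ⟨fun x => ?_, ?_, ?_, ?_⟩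
  · exact ((hu.1 (κ * x)).comp x (differentiableAt_id.const_mul κ)).const_mul √κ
  · simp_rw [massDilation_sq hκ]
    exact (hu.2.1.comp_mul_left' hκ.ne').const_mul κ
  · simp_rw [deriv_massDilation_sq hu.1 hκ]
    exact (hu.2.2.1.comp_mul_left' hκ.ne').const_mul _
  · simp_rw [massDilation_sq hκ]
    rw [integral_const_mul, Measure.integral_comp_mul_left (fun x => u x ^ 2), smul_eq_mul,
      abs_of_pos (inv_pos.2 hκ), hu.2.2.2]
    field_simp

lemma InH1mass.NLSenergy_massDilation (hu : InH1mass μ u) (hμ : 0 < μ) (hκ : 0 < κ) {p q : ℝ}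
    (α : ℝ) (hp : 2 ≤ p) (hq : 2 ≤ q) :
    NLSenergy p q α (_root_.massDilation κ u) = κ ^ 2 * ((1 / 2) * ∫ x, deriv u x ^ 2)
      - κ ^ (p / 2 - 1) * ((1 / p) * ∫ x, |u x| ^ p)
      - κ ^ (q / 2 - 1) * ((α / q) * ∫ x, |u x| ^ q) := by
  rw [(hu.massDilation hκ).NLSenergy_eq hμ α hp hq, integral_deriv_massDilation_sq hu.1 hκ,
    integral_abs_massDilation_rpow hκ, integral_abs_massDilation_rpow hκ]
  ring

end Scaling

lemma rpow_le_sq_add_rpow_mul_pow_six {t T p : ℝ} (ht : 0 ≤ t) (hT : 0 < T) (hp : 2 < p)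
    (hp6 : p < 6) : t ^ p ≤ T ^ (p - 2) * t ^ 2 + T ^ (p - 6) * t ^ 6 := by
  rcases ht.eq_or_lt with rfl | ht
  · simp [Real.zero_rpow (by linarith : p ≠ 0)]
  have h2 : t ^ p = t ^ (p - 2) * t ^ 2 := by
    rw [← Real.rpow_two, ← Real.rpow_add ht]
    ring_nf
  have h6 : t ^ p = t ^ (p - 6) * t ^ 6 := by
    rw [show t ^ 6 = t ^ (6 : ℝ) by exact_mod_cast (Real.rpow_natCast t 6).symm,
      ← Real.rpow_add ht]
    ring_nf
  rcases le_total t T with h | h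
  · have := Real.rpow_le_rpow ht.le h (by linarith : 0 ≤ p - 2)
    rw [h2]
    exact (mul_le_mul_of_nonneg_right this (by positivity)).trans
      (le_add_of_nonneg_right (by positivity))
  · have := Real.rpow_le_rpow_of_nonpos hT h (by linarith : p - 6 ≤ 0)
    rw [h6]
    exact (mul_le_mul_of_nonneg_right this (by positivity)).trans
      (le_add_of_nonneg_left (by positivity))

lemma exists_le_NLSenergy_of_subcritical {p q α μ : ℝ} (hq : 2 < q) (hp : 2 < p) (hp6 : p < 6)
    (hα : α ≤ 0) (hμ : 0 < μ) :
    ∃ K : ℝ, ∀ u, InH1mass μ u → (1 / 4) * (∫ x, deriv u x ^ 2) - K ≤ NLSenergy p q α u := by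
  obtain ⟨T, hT, hT0⟩ : ∃ T : ℝ, T ^ (p - 6) < 1 / (4 * μ ^ 2) ∧ 0 < T := by
    have h := tendsto_rpow_neg_atTop (by linarith : 0 < 6 - p)
    rw [neg_sub] at h
    exact ((h.eventually (gt_mem_nhds (by positivity))).and (eventually_gt_atTop 0)).exists
  refine ⟨T ^ (p - 2) * μ, fun u hu => ?_⟩
  set D := ∫ x, deriv u x ^ 2 with hD
  have hD0 : 0 ≤ D := integral_nonneg fun x => sq_nonneg _
  have hle : (∫ x, |u x| ^ p) ≤ ∫ x, (T ^ (p - 2) + T ^ (p - 6) * (μ * D)) * u x ^ 2 := by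
    refine integral_mono (hu.integrable_abs_rpow hμ hp.le) (hu.2.1.const_mul _) fun x => ?_
    have h1 := rpow_le_sq_add_rpow_mul_pow_six (abs_nonneg (u x)) hT0 hp hp6
    have h2 := mul_le_mul_of_nonneg_left (hu.sq_sq_le hμ x)
      (by positivity : 0 ≤ T ^ (p - 6) * u x ^ 2)
    have h3 : |u x| ^ 6 = (u x ^ 2) ^ 2 * u x ^ 2 := by
      rw [← sq_abs (u x)]
      ring
    rw [sq_abs, h3] at h1
    simp only
    linarith
  rw [integral_const_mul, hu.2.2.2] at hle
  have hTD : T ^ (p - 6) * (μ * D) * μ ≤ D / 4 := by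
    have h1 := mul_le_mul_of_nonneg_right hT.le (by positivity : 0 ≤ μ ^ 2 * D)
    have h2 : 1 / (4 * μ ^ 2) * (μ ^ 2 * D) = D / 4 := by field_simp
    linarith
  have hp0 : 0 ≤ ∫ x, |u x| ^ p := integral_nonneg fun x => by positivity
  have hq0 : 0 ≤ ∫ x, |u x| ^ q := integral_nonneg fun x => by positivity
  have h1p : (1 / p) * (∫ x, |u x| ^ p) ≤ ∫ x, |u x| ^ p :=
    mul_le_of_le_one_left hp0 (by rw [div_le_one (by linarith)]; linarith)
  have hαq : α / q * (∫ x, |u x| ^ q) ≤ 0 :=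
    mul_nonpos_of_nonpos_of_nonneg (div_nonpos_of_nonpos_of_nonneg hα (by linarith)) hq0
  rw [hu.NLSenergy_eq hμ α hp.le hq.le, ← hD]
  linarith

section Soliton

open Real

lemma one_add_sq_le_four_mul_cosh (x : ℝ) : 1 + x ^ 2 ≤ 4 * cosh x := by
  have h1 := quadratic_le_exp_of_nonneg (abs_nonneg x)
  have h2 := cosh_eq |x|
  rw [cosh_abs] at h2
  have := exp_pos (-|x|)
  rw [sq_abs] at h1
  linarith [abs_nonneg x]

lemma integrable_inv_cosh : Integrable fun x : ℝ => (cosh x)⁻¹ := by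
  refine (integrable_inv_one_add_sq.const_mul 4).mono'
    measurable_cosh.inv.aestronglyMeasurable (.of_forall fun x => ?_)
  have hc := cosh_pos x
  rw [norm_of_nonneg (by positivity), ← div_eq_mul_inv, inv_eq_one_div,
    div_le_div_iff₀ hc (by positivity)]
  linarith [one_add_sq_le_four_mul_cosh x]

lemma hasDerivAt_arctan_sinh (x : ℝ) : HasDerivAt (fun x => arctan (sinh x)) (cosh x)⁻¹ x := by
  convert (hasDerivAt_sinh x).arctan using 1
  rw [add_comm, ← cosh_sq]
  have := (cosh_pos x).ne'
  field_simp

lemma integral_inv_cosh : ∫ x : ℝ, (cosh x)⁻¹ = π := by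
  have h := integral_of_hasDerivAt_of_tendsto hasDerivAt_arctan_sinh integrable_inv_cosh
    ((tendsto_nhds_of_tendsto_nhdsWithin tendsto_arctan_atBot).comp sinhOrderIso.tendsto_atBot)
    ((tendsto_nhds_of_tendsto_nhdsWithin tendsto_arctan_atTop).comp sinhOrderIso.tendsto_atTop)
  rw [h]
  ring

lemma integrable_inv_cosh_pow_three : Integrable fun x : ℝ => (cosh x ^ 3)⁻¹ := by
  refine integrable_inv_cosh.mono'
    (measurable_cosh.pow_const 3).inv.aestronglyMeasurable (.of_forall fun x => ?_)
  have hc := cosh_pos x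
  rw [norm_of_nonneg (by positivity)]
  exact inv_anti₀ hc (le_self_pow₀ (one_le_cosh x) (by norm_num))

lemma integral_inv_cosh_pow_three : ∫ x : ℝ, (cosh x ^ 3)⁻¹ = π / 2 := by
  have hd (x : ℝ) : HasDerivAt (fun x => sinh x / cosh x ^ 2)
      (2 * (cosh x ^ 3)⁻¹ - (cosh x)⁻¹) x := by
    have hc := (cosh_pos x).ne'
    refine ((hasDerivAt_sinh x).fun_div ((hasDerivAt_cosh x).fun_pow 2)
      (pow_ne_zero 2 hc)).congr_deriv ?_
    have hs : sinh x ^ 2 = cosh x ^ 2 - 1 := sinh_sq x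
    field_simp
    norm_num
    linear_combination -2 * cosh x * hs
  have hi : Integrable fun x => sinh x / cosh x ^ 2 := by
    refine integrable_inv_cosh.mono'
      (measurable_sinh.div (measurable_cosh.pow_const 2)).aestronglyMeasurable
      (.of_forall fun x => ?_)
    have hc := cosh_pos x
    have : |sinh x| ≤ cosh x := abs_le_of_sq_le_sq (by linarith [cosh_sq x]) hc.le
    rw [norm_eq_abs, abs_div, abs_of_pos (pow_pos hc 2), inv_eq_one_div,
      div_le_div_iff₀ (by positivity) hc]
    nlinarith
  have h := integral_eq_zero_of_hasDerivAt_of_integrable hd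
    ((integrable_inv_cosh_pow_three.const_mul 2).sub integrable_inv_cosh) hi
  rw [integral_sub (integrable_inv_cosh_pow_three.const_mul 2) integrable_inv_cosh,
    integral_const_mul, integral_inv_cosh] at h
  linarith

/-- The profile `√(a / cosh x)` of the critical soliton. -/
noncomputable def solitonProfile (a x : ℝ) : ℝ := √(a / cosh x)

variable {a : ℝ}

lemma solitonProfile_sq (ha : 0 < a) (x : ℝ) : solitonProfile a x ^ 2 = a * (cosh x)⁻¹ := by
  have hc := cosh_pos x
  rw [solitonProfile, sq_sqrt (by positivity), div_eq_mul_inv]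

lemma hasDerivAt_solitonProfile (ha : 0 < a) (x : ℝ) : HasDerivAt (solitonProfile a)
    (a * (-sinh x / cosh x ^ 2) / (2 * solitonProfile a x)) x := by
  have hc := cosh_pos x
  exact (((hasDerivAt_cosh x).inv hc.ne').const_mul a).sqrt (mul_pos ha (inv_pos.2 hc)).ne'

lemma deriv_solitonProfile_sq (ha : 0 < a) (x : ℝ) :
    deriv (solitonProfile a) x ^ 2 = a / 4 * ((cosh x)⁻¹ - (cosh x ^ 3)⁻¹) := by
  have hc := cosh_pos x
  have hs := sinh_sq x
  rw [(hasDerivAt_solitonProfile ha x).deriv, div_pow, mul_pow, mul_pow, div_pow,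
    solitonProfile_sq ha, neg_sq, hs]
  field_simp
  ring

lemma abs_solitonProfile_rpow_six (ha : 0 < a) (x : ℝ) :
    |solitonProfile a x| ^ (6 : ℝ) = a ^ 3 * (cosh x ^ 3)⁻¹ := by
  have : |solitonProfile a x| ^ (6 : ℝ) = (|solitonProfile a x| ^ 2) ^ 3 := by
    rw [← pow_mul]
    exact_mod_cast rpow_natCast _ 6
  rw [this, sq_abs, solitonProfile_sq ha, mul_pow, inv_pow]

lemma inH1mass_solitonProfile (ha : 0 < a) : InH1mass (a * π) (solitonProfile a) := by
  refine ⟨fun x => (hasDerivAt_solitonProfile ha x).differentiableAt, ?_, ?_, ?_⟩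
  · simp_rw [solitonProfile_sq ha]
    exact integrable_inv_cosh.const_mul a
  · simp_rw [deriv_solitonProfile_sq ha]
    exact (integrable_inv_cosh.sub integrable_inv_cosh_pow_three).const_mul _
  · simp_rw [solitonProfile_sq ha]
    rw [integral_const_mul, integral_inv_cosh]

lemma integral_deriv_solitonProfile_sq (ha : 0 < a) :
    ∫ x, deriv (solitonProfile a) x ^ 2 = a * π / 8 := by
  simp_rw [deriv_solitonProfile_sq ha]
  rw [integral_const_mul, integral_sub integrable_inv_cosh integrable_inv_cosh_pow_three,
    integral_inv_cosh, integral_inv_cosh_pow_three]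
  ring

lemma integral_abs_solitonProfile_rpow_six (ha : 0 < a) :
    ∫ x, |solitonProfile a x| ^ (6 : ℝ) = a ^ 3 * π / 2 := by
  simp_rw [abs_solitonProfile_rpow_six ha]
  rw [integral_const_mul, integral_inv_cosh_pow_three]
  ring

lemma exists_inH1mass {μ : ℝ} (hμ : 0 < μ) : ∃ u, InH1mass μ u := by
  have h := inH1mass_solitonProfile (div_pos hμ pi_pos)
  rw [div_mul_cancel₀ _ pi_ne_zero] at h
  exact ⟨_, h⟩

end Soliton

lemma groundLevel_le {p q α μ : ℝ} {u : ℝ → ℝ} (hu : InH1mass μ u) :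
    groundLevel p q α μ ≤ (NLSenergy p q α u : EReal) :=
  sInf_le ⟨u, hu, rfl⟩

lemma le_groundLevel {p q α μ c : ℝ} (h : ∀ u, InH1mass μ u → c ≤ NLSenergy p q α u) :
    (c : EReal) ≤ groundLevel p q α μ := by
  refine le_sInf ?_
  rintro _ ⟨u, hu, rfl⟩
  exact EReal.coe_le_coe_iff.2 (h u hu)

lemma groundLevel_nonpos {p q α μ : ℝ} (hp : 2 < p) (hq : 2 < q) (hμ : 0 < μ) :
    groundLevel p q α μ ≤ 0 := by
  obtain ⟨u, hu⟩ := exists_inH1mass hμ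
  have hrpow {r : ℝ} (hr : 0 < r) : Tendsto (fun κ : ℝ => κ ^ r) (𝓝[>] 0) (𝓝 0) := by
    have := (Real.continuous_rpow_const hr.le).tendsto 0
    rw [Real.zero_rpow hr.ne'] at this
    exact this.mono_left nhdsWithin_le_nhds
  have hsq : Tendsto (fun κ : ℝ => κ ^ 2) (𝓝[>] 0) (𝓝 0) := by
    have := (continuous_pow 2 (M := ℝ)).tendsto 0
    rw [zero_pow two_ne_zero] at this
    exact this.mono_left nhdsWithin_le_nhds
  have hlim : Tendsto (fun κ => NLSenergy p q α (massDilation κ u)) (𝓝[>] 0) (𝓝 0) := by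
    have h := ((hsq.mul_const ((1 / 2) * ∫ x, deriv u x ^ 2)).sub
      ((hrpow (by linarith : 0 < p / 2 - 1)).mul_const ((1 / p) * ∫ x, |u x| ^ p))).sub
      ((hrpow (by linarith : 0 < q / 2 - 1)).mul_const ((α / q) * ∫ x, |u x| ^ q))
    simp only [zero_mul, sub_zero] at h
    refine h.congr' (eventually_mem_nhdsWithin.mono fun κ hκ => ?_)
    exact (hu.NLSenergy_massDilation hμ hκ α hp.le hq.le).symm
  exact ge_of_tendsto ((continuous_coe_real_ereal.tendsto 0).comp hlim)
    (eventually_mem_nhdsWithin.mono fun κ hκ => groundLevel_le (hu.massDilation hκ))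

lemma groundLevel_supercritical_eq_bot {q α μ : ℝ} (hq : 2 < q) (hq6 : q < 6) (hμ : muR < μ) :
    groundLevel 6 q α μ = ⊥ := by
  have hμ0 : 0 < μ := lt_trans (by unfold muR; positivity) hμ
  set a := μ / Real.pi with ha
  have ha0 : 0 < a := div_pos hμ0 Real.pi_pos
  have hμa : a * Real.pi = μ := div_mul_cancel₀ _ Real.pi_ne_zero
  have hu : InH1mass μ (solitonProfile a) := hμa ▸ inH1mass_solitonProfile ha0
  have ha2 : 3 / 4 < a ^ 2 := by
    have h1 : √3 / 2 < a := (lt_div_iff₀ Real.pi_pos).2 hμ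
    have h2 := pow_lt_pow_left₀ h1 (by positivity) two_ne_zero
    rw [div_pow, Real.sq_sqrt (by norm_num)] at h2
    linarith
  set c := a * Real.pi / 12 * (a ^ 2 - 3 / 4) with hc
  have hc0 : 0 < c := mul_pos (by positivity) (sub_pos.2 ha2)
  set B := (α / q) * ∫ x, |solitonProfile a x| ^ q with hB
  have hE (κ : ℝ) (hκ : 0 < κ) : NLSenergy 6 q α (massDilation κ (solitonProfile a)) =
      κ ^ 2 * (-c - κ ^ (q / 2 - 3) * B) := by
    rw [hu.NLSenergy_massDilation hμ0 hκ α (by norm_num) hq.le,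
      integral_deriv_solitonProfile_sq ha0, integral_abs_solitonProfile_rpow_six ha0, ← hB, hc,
      show q / 2 - 1 = 2 + (q / 2 - 3) by ring, Real.rpow_add hκ,
      show (6 : ℝ) / 2 - 1 = 2 by norm_num, Real.rpow_two]
    ring
  have hlim : Tendsto (fun κ => NLSenergy 6 q α (massDilation κ (solitonProfile a)))
      atTop atBot := by
    have h1 := tendsto_rpow_neg_atTop (by linarith : 0 < 3 - q / 2)
    rw [neg_sub] at h1
    have h2 := (h1.mul_const B).const_sub (-c)
    rw [zero_mul, sub_zero] at h2
    refine ((tendsto_pow_atTop two_ne_zero).atTop_mul_neg (neg_lt_zero.2 hc0) h2).congr' ?_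
    exact (eventually_gt_atTop 0).mono fun κ hκ => (hE κ hκ).symm
  rw [EReal.eq_bot_iff_forall_lt]
  intro y
  obtain ⟨κ, hκy, hκ⟩ := ((hlim.eventually (eventually_lt_atBot y)).and
    (eventually_gt_atTop 0)).exists
  exact (groundLevel_le (hu.massDilation hκ)).trans_lt (EReal.coe_lt_coe_iff.2 hκy)

lemma NLSenergy_critical_pos {q α μ : ℝ} {u : ℝ → ℝ} (hq : 2 < q) (hα : α < 0) (hμ : 0 < μ)
    (hμR : μ ≤ muR) (hu : InH1mass μ u) : 0 < NLSenergy 6 q α u := by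
  obtain ⟨m, hm, h⟩ := hu.sharp_critical_bound hμ
  have h0 : 0 ≤ m ^ 2 * (muR - μ) := mul_nonneg (sq_nonneg m) (sub_nonneg.2 hμR)
  have hαq : α / q * (∫ x, |u x| ^ q) < 0 :=
    mul_neg_of_neg_of_pos (div_neg_of_neg_of_pos hα (by linarith))
      (hu.integral_abs_rpow_pos hμ hq.le)
  rw [hu.NLSenergy_eq hμ α (by norm_num) hq.le]
  linarith

/-- defocusing case, boundedness/coercivity for p < 6,
unboundedness above μ_ℝ, and vanishing non-attained level below μ_ℝ (p = 6). -/
theorem defocusing_boundedness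
    (p q α μ : ℝ) (hq : 2 < q) (hqp : q < p) (hp : p ≤ 6) (hα : α < 0) :
    (p < 6 → 0 < μ →
      (⊥ < groundLevel p q α μ ∧ groundLevel p q α μ ≤ 0) ∧
      (∀ u : ℕ → ℝ → ℝ, (∀ n, InH1mass μ (u n)) →
        (∃ C : ℝ, ∀ n, NLSenergy p q α (u n) ≤ C) →
        ∃ C : ℝ, ∀ n, (∫ x : ℝ, (deriv (u n) x) ^ 2) ≤ C)) ∧
    (p = 6 → muR < μ → groundLevel p q α μ = ⊥) ∧
    (p = 6 → 0 < μ → μ ≤ muR →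
      groundLevel p q α μ = 0 ∧
      ¬ ∃ u : ℝ → ℝ, InH1mass μ u ∧
        ((NLSenergy p q α u : ℝ) : EReal) = groundLevel p q α μ) := by
  refine ⟨fun hp6 hμ => ?_, ?_, ?_⟩
  · obtain ⟨K, hK⟩ := exists_le_NLSenergy_of_subcritical hq (hq.trans hqp) hp6 hα.le hμ
    refine ⟨⟨?_, groundLevel_nonpos (hq.trans hqp) hq hμ⟩, fun u hu => ?_⟩
    · refine (EReal.bot_lt_coe (-K)).trans_le (le_groundLevel fun u hu => ?_)
      have : 0 ≤ ∫ x, deriv u x ^ 2 := integral_nonneg fun x => sq_nonneg _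
      linarith [hK u hu]
    · rintro ⟨C, hC⟩
      exact ⟨4 * (C + K), fun n => by linarith [hK _ (hu n), hC n]⟩
  · rintro rfl hμ
    exact groundLevel_supercritical_eq_bot hq hqp hμ
  · rintro rfl hμ hμR
    have h0 : groundLevel 6 q α μ = 0 := (groundLevel_nonpos (by norm_num) hq hμ).antisymm
      (le_groundLevel fun u hu => (NLSenergy_critical_pos hq hα hμ hμR hu).le)
    refine ⟨h0, ?_⟩
    rintro ⟨u, hu, h⟩
    rw [h0] at h
    exact (NLSenergy_critical_pos hq hα hμ hμR hu).ne' (EReal.coe_eq_zero.1 h)
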